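/- arXiv:2010.00901 — 3 statements merged into one kernel-verified Lean document; each statement's English description precedes it below -/
import Mathlib

section
/- Let L be a binary relational language and let M be an L-structure. Then M is 2-isomorphic to some transitive L-structure N if and only if M is 2-homogeneous. -/
namespace AN

/-- Formulas of first-order logic over a binary relational language `L`
(a type whose elements are the binary relation symbols; there are no
function or constant symbols) with variables from `V`. -/
inductive FOV (L : Type) (V : Type) : Type
  | eq : V → V → FOV L V
  | rel : L → V → V → FOV L V
  | not : FOV L V → FOV L V
  | and : FOV L V → FOV L V → FOV L V
  | ex : V → FOV L V → FOV L V

/-- An `L`-structure on universe `M`: an interpretation of each binary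
relation symbol as a binary relation on `M`. -/
abbrev Str (L M : Type) := L → M → M → Prop

/-- Satisfaction of a formula in a structure under a valuation of the variables. -/
def Sat {L V M : Type} [DecidableEq V] (S : Str L M) : FOV L V → (V → M) → Prop
  | .eq i j, v => v i = v j
  | .rel r i j, v => S r (v i) (v j)
  | .not φ, v => ¬ Sat S φ v
  | .and φ ψ, v => Sat S φ v ∧ Sat S ψ v
  | .ex i φ, v => ∃ m : M, Sat S φ (Function.update v i m)

/-- The free variables of a formula. -/
def Free {L V : Type} : FOV L V → Set V
  | .eq i j => {i, j}
  | .rel _ i j => {i, j}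
  | .not φ => Free φ
  | .and φ ψ => Free φ ∪ Free ψ
  | .ex i φ => Free φ \ {i}

/-- A sentence is a formula with no free variables. -/
def Sentence {L V : Type} (φ : FOV L V) : Prop := Free φ = ∅

/-- The two-variable fragment FO2(L): formulas built from the two variables x, y. -/
abbrev FO2 (L : Type) := FOV L (Fin 2)

/-- The three-variable fragment FO3(L): formulas built from the three variables x, y, z. -/
abbrev FO3 (L : Type) := FOV L (Fin 3)

/-- `M ⊨ φ[a,b]` : the FO2-formula φ holds with x interpreted as a and y as b. -/
def Sat2 {L M : Type} (S : Str L M) (φ : FO2 L) (a b : M) : Prop :=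
  Sat S φ ![a, b]

/-- The 2-type of the pair (a,b) in the structure: all FO2-formulas true of (a,b). -/
def Type2 {L M : Type} (S : Str L M) (a b : M) : Set (FO2 L) :=
  {φ | Sat2 S φ a b}

/-- `f` is an automorphism of the structure `S`. -/
def IsAuto {L M : Type} (S : Str L M) (f : M ≃ M) : Prop :=
  ∀ r a b, S r a b ↔ S r (f a) (f b)

/-- A structure is transitive if any two elements of the same type are
connected by an automorphism. -/
def IsTransitive {L M : Type} (S : Str L M) : Prop :=
  ∀ a b : M, Type2 S a a = Type2 S b b →
    ∃ f : M ≃ M, IsAuto S f ∧ f a = b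

/-- A structure is 2-homogeneous if whenever a and b have the same type,
every c can be matched by some d with Type(a,c) = Type(b,d). -/
def IsHomog2 {L M : Type} (S : Str L M) : Prop :=
  ∀ a b c : M, Type2 S a a = Type2 S b b →
    ∃ d : M, Type2 S a c = Type2 S b d

/-- A 2-partial isomorphism between `S` and `T`, presented by its part `i1`
relating elements and its part `i2` relating pairs. -/
structure IsTwoIso {L M N : Type} (S : Str L M) (T : Str L N)
    (i1 : M → N → Prop) (i2 : M → M → N → N → Prop) : Prop where
  eq_iff : ∀ a b a' b', i2 a b a' b' → (a = b ↔ a' = b')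
  rel_iff2 : ∀ a b a' b', i2 a b a' b' → ∀ r,
      (S r a a ↔ T r a' a') ∧ (S r a b ↔ T r a' b') ∧
      (S r b a ↔ T r b' a') ∧ (S r b b ↔ T r b' b')
  rel_iff1 : ∀ a a', i1 a a' → ∀ r, S r a a ↔ T r a' a'
  restrict : ∀ a b a' b', i2 a b a' b' → i1 a a' ∧ i1 b b'
  forth1 : ∀ a, ∃ a', i1 a a'
  back1 : ∀ a', ∃ a, i1 a a'
  forth2 : ∀ a a', i1 a a' → ∀ b, ∃ b', i2 a b a' b'
  back2 : ∀ a a', i1 a a' → ∀ b', ∃ b, i2 a b a' b'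

/-- Two structures are 2-isomorphic when some 2-partial isomorphism between
them exists. -/
def TwoIsomorphic {L M N : Type} (S : Str L M) (T : Str L N) : Prop :=
  ∃ i1 i2, IsTwoIso S T i1 i2

/-- 2-equivalence: the same FO2 sentences hold in both structures. -/
def Equiv2 {L M N : Type} (S : Str L M) (T : Str L N) : Prop :=
  ∀ φ : FO2 L, Sentence φ → ((∀ v, Sat S φ v) ↔ (∀ v, Sat T φ v))

/-- 3-equivalence: the same FO3 sentences hold in both structures. -/
def Equiv3 {L M N : Type} (S : Str L M) (T : Str L N) : Prop :=
  ∀ φ : FO3 L, Sentence φ → ((∀ v, Sat S φ v) ↔ (∀ v, Sat T φ v))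

/-- Expansion of an `L`-structure by one new binary relation `R`; the new
relation symbol is `Sum.inr ()`, so the expanded language is `L ⊕ Unit`. -/
def expand {L M : Type} (S : Str L M) (R : M → M → Prop) : Str (L ⊕ Unit) M :=
  Sum.elim S (fun _ => R)

/-- `S` is a model of the set `Th` of sentences. -/
def ModelsSet {L V M : Type} [DecidableEq V] (S : Str L M) (Th : Set (FOV L V)) : Prop :=
  ∀ φ ∈ Th, ∀ v : V → M, Sat S φ v

/-- `Sg` is a weak implicit definition of the new relation symbol w.r.t. `Th`:
in each model of `Th` there is at most one relation satisfying `Sg`. -/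
def WeakImplicitDef (L : Type) (Th : Set (FO2 L)) (Sg : Set (FO2 (L ⊕ Unit))) : Prop :=
  ∀ (M : Type) (S : Str L M), Nonempty M → ModelsSet S Th →
    ∀ R R' : M → M → Prop,
      ModelsSet (expand S R) Sg → ModelsSet (expand S R') Sg → R = R'

/-- `Sg` is a strong implicit definition of the new relation symbol w.r.t. `Th`:
in each model of `Th` there is exactly one relation satisfying `Sg`. -/
def StrongImplicitDef (L : Type) (Th : Set (FO2 L)) (Sg : Set (FO2 (L ⊕ Unit))) : Prop :=
  ∀ (M : Type) (S : Str L M), Nonempty M → ModelsSet S Th →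
    ∃! R : M → M → Prop, ModelsSet (expand S R) Sg

/-- `Sg` can be made explicit w.r.t. `Th`: there is an FO2(L)-formula φ(x,y)
with Th ∪ Sg ⊨ ∀x∀y (R(x,y) ↔ φ(x,y)). -/
def MadeExplicit (L : Type) (Th : Set (FO2 L)) (Sg : Set (FO2 (L ⊕ Unit))) : Prop :=
  ∃ φ : FO2 L, ∀ (M : Type) (S : Str L M), Nonempty M → ModelsSet S Th →
    ∀ R : M → M → Prop, ModelsSet (expand S R) Sg →
      ∀ a b : M, R a b ↔ Sat2 S φ a b

/-- `R` does not cut 2-types in `S`. -/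
def NoCut {L M : Type} (S : Str L M) (R : M → M → Prop) : Prop :=
  ∀ a b c d : M, Type2 S a b = Type2 S c d → (R a b ↔ R c d)

/-- The valuation sending the variable `0` (i.e. x) to `m` and the variables
`1,…,k` (the constants naming the tuple `t`) to the entries of `t`. -/
def valCons {M : Type} (m : M) {k : ℕ} (t : Fin k → M) : ℕ → M :=
  fun i => if h : 0 < i ∧ i - 1 < k then t ⟨i - 1, h.2⟩ else m

/-- ω-saturation, phrased with formulas whose free variables are among
x = variable 0 and the constants = variables 1,…,k naming a finite tuple t:
if every finite subset of Γ(x) is satisfiable in (M,t), then Γ(x) is realized. -/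
def OmegaSaturated {L M : Type} (S : Str L M) : Prop :=
  ∀ (k : ℕ) (t : Fin k → M) (Γ : Set (FOV L ℕ)),
    (∀ φ ∈ Γ, Free φ ⊆ {i | i ≤ k}) →
    (∀ Γ₀ : Finset (FOV L ℕ), ↑Γ₀ ⊆ Γ →
        ∃ m : M, ∀ φ ∈ Γ₀, Sat S φ (valCons m t)) →
    ∃ m : M, ∀ φ ∈ Γ, Sat S φ (valCons m t)

/-- The new relation symbol cannot cut the formula π:
Th ∪ Sg ⊨ ∀x∀y(π → R(x,y)) or Th ∪ Sg ⊨ ∀x∀y(π → ¬R(x,y)). -/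
def CannotCut (L : Type) (Th : Set (FO2 L)) (Sg : Set (FO2 (L ⊕ Unit))) (π : FO2 L) : Prop :=
  (∀ (M : Type) (S : Str L M), Nonempty M → ModelsSet S Th →
      ∀ R : M → M → Prop, ModelsSet (expand S R) Sg →
        ∀ a b : M, Sat2 S π a b → R a b) ∨
  (∀ (M : Type) (S : Str L M), Nonempty M → ModelsSet S Th →
      ∀ R : M → M → Prop, ModelsSet (expand S R) Sg →
        ∀ a b : M, Sat2 S π a b → ¬ R a b)

/-- `π` is a 2-partition with respect to Th ∪ Sg: Th ∪ Sg ⊨ ∀x∀y ⋁ᵢ πᵢ and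
Th ∪ Sg ⊨ ∀x∀y ¬(πᵢ ∧ πⱼ) for i < j. -/
def IsTwoPartition (L : Type) (Th : Set (FO2 L)) (Sg : Set (FO2 (L ⊕ Unit)))
    {n : ℕ} (π : Fin (n + 1) → FO2 L) : Prop :=
  ∀ (M : Type) (S : Str L M), Nonempty M → ModelsSet S Th →
    ∀ R : M → M → Prop, ModelsSet (expand S R) Sg →
      (∀ a b : M, ∃ i, Sat2 S (π i) a b) ∧
      (∀ a b : M, ∀ i j : Fin (n + 1), i < j →
        ¬(Sat2 S (π i) a b ∧ Sat2 S (π j) a b))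

/-- The binary relation defined in `S` by an FO3-formula ρ(x,y) with free
variables among x = 0 and y = 1 (the value of z is immaterial). -/
def rel3 {L M : Type} (S : Str L M) (ρ : FO3 L) : Set (M × M) :=
  {p | Sat S ρ ![p.1, p.2, p.2]}

/-- The FO3-definable binary relations of `S`. -/
def Def3 {L M : Type} (S : Str L M) : Set (Set (M × M)) :=
  {Z | ∃ ρ : FO3 L, Free ρ ⊆ ({0, 1} : Set (Fin 3)) ∧ Z = rel3 S ρ}

/-- Converse of a binary relation. -/
def conv {M : Type} (Z : Set (M × M)) : Set (M × M) := {p | (p.2, p.1) ∈ Z}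

/-- Composition of binary relations. -/
def comp {M : Type} (Z W : Set (M × M)) : Set (M × M) :=
  {p | ∃ v, (p.1, v) ∈ Z ∧ (v, p.2) ∈ W}

/-! ### Basic properties of 2-types -/

/-- Rename the variables of a formula along a bijection. -/
def rename {L V : Type} (e : V ≃ V) : FOV L V → FOV L V
  | .eq i j => .eq (e i) (e j)
  | .rel r i j => .rel r (e i) (e j)
  | .not φ => .not (rename e φ)
  | .and φ ψ => .and (rename e φ) (rename e ψ)
  | .ex i φ => .ex (e i) (rename e φ)

theorem sat_rename {L V M : Type} [DecidableEq V] (S : Str L M) (e : V ≃ V) (φ : FOV L V) :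
    ∀ v : V → M, Sat S (rename e φ) v ↔ Sat S φ (v ∘ e) := by
  induction φ with
  | eq i j => intro v; rfl
  | rel r i j => intro v; rfl
  | not φ ih => intro v; exact not_congr (ih v)
  | and φ ψ ih₁ ih₂ => intro v; exact and_congr (ih₁ v) (ih₂ v)
  | ex i φ ih =>
    intro v
    refine exists_congr fun m => ?_
    rw [ih, Function.update_comp_equiv, Equiv.symm_apply_apply]

section Types

variable {L M : Type} {S : Str L M} {a b c d : M}

theorem Type2.sat_iff (h : Type2 S a b = Type2 S c d) (φ : FO2 L) :
    Sat S φ ![a, b] ↔ Sat S φ ![c, d] :=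
  Set.ext_iff.1 h φ

theorem Type2.eq_iff (h : Type2 S a b = Type2 S c d) : a = b ↔ c = d :=
  Type2.sat_iff h (.eq 0 1)

theorem Type2.swap (h : Type2 S a b = Type2 S c d) : Type2 S b a = Type2 S d c := by
  have key : ∀ x y : M, (![x, y] ∘ Equiv.swap (0 : Fin 2) 1) = ![y, x] := by
    intro x y
    funext i
    fin_cases i <;> simp
  ext φ
  have := Type2.sat_iff h (rename (Equiv.swap 0 1) φ)
  rwa [sat_rename, sat_rename, key, key] at this

theorem Type2.left (h : Type2 S a b = Type2 S c d) : Type2 S a a = Type2 S c c := by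
  have key : ∀ (φ : FO2 L) (x y : M),
      Sat S (.ex 1 (.and (.eq 0 1) φ)) ![x, y] ↔ Sat S φ ![x, x] := by
    intro φ x y
    have upd : ∀ m : M, Function.update ![x, y] 1 m = ![x, m] := by
      intro m
      funext i
      fin_cases i <;> simp
    simp [Sat, upd]
  ext φ
  have := Type2.sat_iff h (.ex 1 (.and (.eq 0 1) φ))
  rwa [key, key] at this

theorem Type2.right (h : Type2 S a b = Type2 S c d) : Type2 S b b = Type2 S d d :=
  Type2.left (Type2.swap h)

/-- Over an element that is the only one of its type, the 2-type of a pair is determined by the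
type of the other element. -/
theorem IsHomog2.type2_eq_of_unique_right (hS : IsHomog2 S)
    (ha : ∀ x, Type2 S x x = Type2 S a a → x = a) (h : Type2 S b b = Type2 S c c) :
    Type2 S b a = Type2 S c a := by
  obtain ⟨x, hx⟩ := hS b c a h
  obtain rfl := ha x (Type2.right hx).symm
  exact hx

theorem IsAuto.isTwoIso {f : M ≃ M} (hf : IsAuto S f) :
    IsTwoIso S S (fun x y => f x = y) (fun x y x' y' => f x = x' ∧ f y = y') where
  eq_iff := by rintro a b _ _ ⟨rfl, rfl⟩; simp
  rel_iff2 := by rintro a b _ _ ⟨rfl, rfl⟩ r; exact ⟨hf .., hf .., hf .., hf ..⟩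
  rel_iff1 := by rintro a _ rfl r; exact hf ..
  restrict := by rintro a b _ _ h; exact h
  forth1 := fun a => ⟨_, rfl⟩
  back1 := f.surjective
  forth2 := fun a a' h b => ⟨f b, h, rfl⟩
  back2 := fun a a' h b' => ⟨f.symm b', h, f.apply_symm_apply b'⟩

end Types

/-! ### 2-isomorphisms preserve 2-types -/

section TwoIso

variable {L M N : Type} {S : Str L M} {T : Str L N} {i1 : M → N → Prop}
  {i2 : M → M → N → N → Prop}

theorem IsTwoIso.sat_iff (h : IsTwoIso S T i1 i2) (φ : FO2 L) :
    ∀ (v : Fin 2 → M) (w : Fin 2 → N),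
      (i2 (v 0) (v 1) (w 0) (w 1) ∨ i2 (v 1) (v 0) (w 1) (w 0)) →
        (Sat S φ v ↔ Sat T φ w) := by
  induction φ with
  | eq i j =>
    intro v w hvw
    have h01 : v 0 = v 1 ↔ w 0 = w 1 := by
      rcases hvw with hvw | hvw
      · exact h.eq_iff _ _ _ _ hvw
      · rw [eq_comm, h.eq_iff _ _ _ _ hvw, eq_comm]
    have h10 : v 1 = v 0 ↔ w 1 = w 0 := by rw [eq_comm, h01, eq_comm]
    fin_cases i <;> fin_cases j <;> simp [Sat, h01, h10]
  | rel r i j =>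
    intro v w hvw
    have key : (S r (v 0) (v 0) ↔ T r (w 0) (w 0)) ∧ (S r (v 0) (v 1) ↔ T r (w 0) (w 1)) ∧
        (S r (v 1) (v 0) ↔ T r (w 1) (w 0)) ∧ (S r (v 1) (v 1) ↔ T r (w 1) (w 1)) := by
      rcases hvw with hvw | hvw
      · exact h.rel_iff2 _ _ _ _ hvw r
      · have := h.rel_iff2 _ _ _ _ hvw r
        tauto
    obtain ⟨h00, h01, h10, h11⟩ := key
    fin_cases i <;> fin_cases j <;> simp [Sat, h00, h01, h10, h11]
  | not φ ih => intro v w hvw; exact not_congr (ih v w hvw)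
  | and φ ψ ih₁ ih₂ => intro v w hvw; exact and_congr (ih₁ v w hvw) (ih₂ v w hvw)
  | ex i φ ih =>
    intro v w hvw
    have hr : i1 (v 0) (w 0) ∧ i1 (v 1) (w 1) := by
      rcases hvw with hvw | hvw
      · exact h.restrict _ _ _ _ hvw
      · exact (h.restrict _ _ _ _ hvw).symm
    constructor
    · rintro ⟨m, hm⟩
      fin_cases i
      · obtain ⟨n, hn⟩ := h.forth2 _ _ hr.2 m
        exact ⟨n, (ih _ _ (Or.inr (by simpa using hn))).1 hm⟩
      · obtain ⟨n, hn⟩ := h.forth2 _ _ hr.1 m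
        exact ⟨n, (ih _ _ (Or.inl (by simpa using hn))).1 hm⟩
    · rintro ⟨n, hn⟩
      fin_cases i
      · obtain ⟨m, hm⟩ := h.back2 _ _ hr.2 n
        exact ⟨m, (ih _ _ (Or.inr (by simpa using hm))).2 hn⟩
      · obtain ⟨m, hm⟩ := h.back2 _ _ hr.1 n
        exact ⟨m, (ih _ _ (Or.inl (by simpa using hm))).2 hn⟩

theorem IsTwoIso.type2_eq (h : IsTwoIso S T i1 i2) {a b : M} {a' b' : N} (hab : i2 a b a' b') :
    Type2 S a b = Type2 T a' b' := by
  ext φ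
  exact h.sat_iff φ _ _ (Or.inl hab)

theorem IsTwoIso.type2_self_eq (h : IsTwoIso S T i1 i2) {a : M} {a' : N} (ha : i1 a a') :
    Type2 S a a = Type2 T a' a' := by
  obtain ⟨b', hb'⟩ := h.forth2 a a' ha a
  obtain rfl := (h.eq_iff _ _ _ _ hb').1 rfl
  exact h.type2_eq hb'

theorem IsTwoIso.isHomog2 (h : IsTwoIso S T i1 i2) (hT : IsTransitive T) : IsHomog2 S := by
  intro a b c hab
  obtain ⟨a', ha⟩ := h.forth1 a
  obtain ⟨b', hb⟩ := h.forth1 b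
  obtain ⟨f, hf, rfl⟩ := hT a' b' (by rw [← h.type2_self_eq ha, ← h.type2_self_eq hb, hab])
  obtain ⟨c', hc⟩ := h.forth2 a a' ha c
  obtain ⟨d, hd⟩ := h.back2 b (f a') hb (f c')
  exact ⟨d, by rw [h.type2_eq hc, h.type2_eq hd, hf.isTwoIso.type2_eq ⟨rfl, rfl⟩]⟩

end TwoIso

/-! ### Structures read off from a labelling of pairs by pairs of `M` -/

/-- A labelling of the pairs of `N` by pairs of `M` from which a structure on `N` that is
2-isomorphic to `S` can be read off. -/
structure IsLabelling {L M N : Type} (S : Str L M) (base : N → M) (lab : N → N → M × M) :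
    Prop where
  type_fst : ∀ x y, Type2 S (lab x y).1 (lab x y).1 = Type2 S (base x) (base x)
  swap : ∀ x y, lab y x = (lab x y).swap
  eq_iff : ∀ x y, (lab x y).1 = (lab x y).2 ↔ x = y
  exists_base : ∀ a, ∃ x, Type2 S a a = Type2 S (base x) (base x)
  exists_lab : ∀ x a b, Type2 S a a = Type2 S (base x) (base x) →
    ∃ y, Type2 S a b = Type2 S (lab x y).1 (lab x y).2

namespace IsLabelling

variable {L M N : Type} {S : Str L M} {base : N → M} {lab : N → N → M × M}

theorem isTwoIso (hl : IsLabelling S base lab) (hS : IsHomog2 S) :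
    IsTwoIso S (fun r x y => S r (lab x y).1 (lab x y).2)
      (fun a x => Type2 S a a = Type2 S (base x) (base x))
      (fun a b x y => Type2 S a b = Type2 S (lab x y).1 (lab x y).2) := by
  have type_snd : ∀ x y, Type2 S (lab x y).2 (lab x y).2 = Type2 S (base y) (base y) := by
    intro x y
    rw [← hl.type_fst y x, hl.swap x y, Prod.fst_swap]
  have rel_self : ∀ a x, Type2 S a a = Type2 S (base x) (base x) → ∀ r,
      S r a a ↔ S r (lab x x).1 (lab x x).2 := by
    intro a x h r
    rw [← (hl.eq_iff x x).2 rfl]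
    exact Type2.sat_iff (h.trans (hl.type_fst x x).symm) (.rel r 0 0)
  have restrict : ∀ a b x y, Type2 S a b = Type2 S (lab x y).1 (lab x y).2 →
      Type2 S a a = Type2 S (base x) (base x) ∧ Type2 S b b = Type2 S (base y) (base y) :=
    fun a b x y h => ⟨(Type2.left h).trans (hl.type_fst x y), (Type2.right h).trans (type_snd x y)⟩
  refine ⟨?_, ?_, rel_self, restrict, hl.exists_base, ?_, ?_, ?_⟩
  · intro a b x y h
    exact (Type2.eq_iff h).trans (hl.eq_iff x y)
  · intro a b x y h r
    refine ⟨rel_self a x (restrict a b x y h).1 r, Type2.sat_iff h (.rel r 0 1), ?_,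
      rel_self b y (restrict a b x y h).2 r⟩
    rw [hl.swap x y]
    exact Type2.sat_iff h (.rel r 1 0)
  · exact fun x => ⟨base x, rfl⟩
  · exact fun a x h b => hl.exists_lab x a b h
  · intro a x h y
    obtain ⟨b, hb⟩ := hS _ a (lab x y).2 ((hl.type_fst x y).trans h.symm)
    exact ⟨b, hb.symm⟩

theorem isTransitive (hl : IsLabelling S base lab) (hS : IsHomog2 S)
    (htrans : ∀ x y, Type2 S (base x) (base x) = Type2 S (base y) (base y) →
      ∃ f : N ≃ N, (∀ z w, lab (f z) (f w) = lab z w) ∧ f x = y) :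
    IsTransitive (fun r x y => S r (lab x y).1 (lab x y).2) := by
  intro x y hxy
  have h := hl.isTwoIso hS
  obtain ⟨f, hf, hfx⟩ := htrans x y <| by
    rw [h.type2_self_eq (a := base x) rfl, h.type2_self_eq (a := base y) rfl, hxy]
  exact ⟨f, fun r z w => by simp only [hf], hfx⟩

end IsLabelling

/-! ### Construction of a labelling with a transitive symmetry group -/

/-- Every type embeds into the positive elements of some linearly ordered abelian group. -/
theorem exists_pos_embedding (I : Type) :
    ∃ (G : Type) (_ : AddCommGroup G) (_ : LinearOrder G) (_ : IsOrderedAddMonoid G) (e : I → G),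
      Function.Injective e ∧ ∀ i, 0 < e i := by
  classical
  let _ : LinearOrder I := linearOrderOfSTO WellOrderingRel
  refine ⟨Lex (I →₀ ℤ), inferInstance, inferInstance, inferInstance,
    fun i => toLex (Finsupp.single i 1), ?_, ?_⟩
  · intro i j hij
    exact Finsupp.single_left_injective one_ne_zero (toLex.injective hij)
  · intro i
    refine lt_of_le_of_ne ?_ ?_
    · exact Finsupp.toLex_monotone (Finsupp.single_nonneg.2 zero_le_one)
    · intro h
      exact one_ne_zero (Finsupp.single_eq_zero.1 (toLex.injective h.symm))

/-- A function on a linearly ordered group that satisfies `c q p (-g) = (c p q g).swap`, prescribed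
on positive elements by `f` and at zero by `o`. -/
def oddExtension {Q G M : Type} [AddCommGroup G] [LinearOrder G] (f : Q → Q → G → M × M)
    (o : Q → M) (p q : Q) (g : G) : M × M :=
  if 0 < g then f p q g else if g = 0 then (o p, o q) else (f q p (-g)).swap

section OddExtension

variable {Q G M : Type} [AddCommGroup G] [LinearOrder G]
  (f : Q → Q → G → M × M) (o : Q → M) (p q : Q)

theorem oddExtension_zero : oddExtension f o p q 0 = (o p, o q) := by
  simp [oddExtension]

theorem oddExtension_of_pos {g : G} (hg : 0 < g) : oddExtension f o p q g = f p q g := by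
  simp [oddExtension, hg]

variable [IsOrderedAddMonoid G]

theorem oddExtension_neg (g : G) : oddExtension f o q p (-g) = (oddExtension f o p q g).swap := by
  rcases lt_trichotomy g 0 with hg | rfl | hg
  · simp [oddExtension, hg, hg.not_gt, hg.ne]
  · simp [oddExtension]
  · simp [oddExtension, hg, hg.not_gt, hg.ne']

end OddExtension

/-- Two elements are equivalent when they have the same type in `S`. -/
def typeSetoid {L M : Type} (S : Str L M) : Setoid M := Setoid.ker fun a => Type2 S a a

/-- A type is royal if it is realized by exactly one element. -/
def Royal {L M : Type} (S : Str L M) (q : Quotient (typeSetoid S)) : Prop :=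
  ∀ a b : M, Quotient.mk (typeSetoid S) a = q → Quotient.mk (typeSetoid S) b = q → a = b

section Labelling

variable {L M : Type} {S : Str L M}

theorem mk_eq_mk {a b : M} :
    Quotient.mk (typeSetoid S) a = Quotient.mk (typeSetoid S) b ↔ Type2 S a a = Type2 S b b :=
  Quotient.eq

theorem type2_out (a : M) :
    Type2 S (Quotient.mk (typeSetoid S) a).out (Quotient.mk (typeSetoid S) a).out = Type2 S a a :=
  mk_eq_mk.1 (Quotient.out_eq _)

theorem exists_ne_of_not_royal {p : Quotient (typeSetoid S)} (hp : ¬ Royal S p)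
    (q : Quotient (typeSetoid S)) :
    ∃ s : M × M, Quotient.mk (typeSetoid S) s.1 = p ∧ Quotient.mk (typeSetoid S) s.2 = q ∧
      s.1 ≠ s.2 := by
  simp only [Royal, not_forall] at hp
  obtain ⟨a, b, ha, hb, hab⟩ := hp
  by_cases h : a = q.out
  · exact ⟨(b, q.out), hb, Quotient.out_eq q, fun h' => hab (h.trans h'.symm)⟩
  · exact ⟨(a, q.out), ha, Quotient.out_eq q, h⟩

/-- The universe of the transitive structure: one point for every royal type and a copy of `G`
for every other type. -/
abbrev Cover {L M : Type} (S : Str L M) (G : Type) : Type :=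
  {q : Quotient (typeSetoid S) // Royal S q} ⊕ ({q : Quotient (typeSetoid S) // ¬ Royal S q} × G)

/-- The type of a point of the cover. -/
def Cover.pointType {G : Type} : Cover S G → Quotient (typeSetoid S)
  | .inl k => k.1
  | .inr x => x.1.1

/-- A representative in `M` of the type of a point of the cover. -/
noncomputable def Cover.base {G : Type} (x : Cover S G) : M := x.pointType.out

/-- The label of a pair of points of the cover; it is invariant under translation by `G`. -/
noncomputable def Cover.lab {G : Type} [AddCommGroup G] [LinearOrder G]
    (f : {q // ¬ Royal S q} → {q // ¬ Royal S q} → G → M × M) : Cover S G → Cover S G → M × M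
  | .inr x, .inr y => oddExtension f (fun q => q.1.out) x.1 y.1 (y.2 - x.2)
  | x, y => (x.base, y.base)

theorem Cover.exists_translation {G : Type} [AddCommGroup G] [LinearOrder G]
    (f : {q // ¬ Royal S q} → {q // ¬ Royal S q} → G → M × M) (x y : Cover S G)
    (h : x.pointType = y.pointType) :
    ∃ t : Cover S G ≃ Cover S G, (∀ z w, Cover.lab f (t z) (t w) = Cover.lab f z w) ∧ t x = y := by
  rcases x with ⟨p, hp⟩ | ⟨⟨p, hp⟩, g⟩ <;> rcases y with ⟨q, hq⟩ | ⟨⟨q, hq⟩, g'⟩ <;>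
    obtain rfl : p = q := h
  · exact ⟨Equiv.refl _, fun _ _ => rfl, rfl⟩
  · exact absurd hp hq
  · exact absurd hq hp
  · refine ⟨Equiv.sumCongr (Equiv.refl _)
      (Equiv.prodCongr (Equiv.refl _) (Equiv.addRight (g' - g))), ?_, by simp⟩
    rintro (z | z) (w | w) <;> simp [Cover.lab, Cover.base, Cover.pointType]

/-- The conditions on `f` under which `Cover.lab f` is a labelling. -/
theorem Cover.isLabelling (hS : IsHomog2 S) {G : Type} [AddCommGroup G] [LinearOrder G]
    [IsOrderedAddMonoid G] (f : {q // ¬ Royal S q} → {q // ¬ Royal S q} → G → M × M)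
    (hf : ∀ p q g, Quotient.mk (typeSetoid S) (f p q g).1 = p.1 ∧
      Quotient.mk (typeSetoid S) (f p q g).2 = q.1 ∧ (f p q g).1 ≠ (f p q g).2)
    (hsurj : ∀ (p q : {q // ¬ Royal S q}) (a b : M), Quotient.mk (typeSetoid S) a = p.1 →
      Quotient.mk (typeSetoid S) b = q.1 → a ≠ b → ∃ g, 0 < g ∧ f p q g = (a, b)) :
    IsLabelling S Cover.base (Cover.lab f) := by
  have royal_out : ∀ a : M, Royal S (Quotient.mk (typeSetoid S) a) →
      (Quotient.mk (typeSetoid S) a).out = a := fun a h => h _ _ (Quotient.out_eq _) rfl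
  have royal_unique : ∀ a : M, Royal S (Quotient.mk (typeSetoid S) a) →
      ∀ x, Type2 S x x = Type2 S a a → x = a := fun a h x hx => h _ _ (mk_eq_mk.2 hx) rfl
  have mk_base : ∀ x : Cover S G, Quotient.mk (typeSetoid S) x.base = x.pointType :=
    fun x => Quotient.out_eq _
  have base_eq : ∀ x y : Cover S G, x.base = y.base ↔ x.pointType = y.pointType := by
    intro x y
    exact ⟨fun h => by rw [← mk_base, h, mk_base], fun h => by rw [Cover.base, h, Cover.base]⟩
  refine ⟨?_, ?_, ?_, ?_, ?_⟩
  · rintro (x | ⟨p, g⟩) (y | ⟨q, g'⟩)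
    iterate 3 rfl
    rw [← mk_eq_mk, mk_base]
    change Quotient.mk _ (oddExtension f (fun q => q.1.out) p q (g' - g)).1 = p.1
    unfold oddExtension
    split_ifs
    · exact (hf _ _ _).1
    · exact Quotient.out_eq _
    · exact (hf _ _ _).2.1
  · rintro (x | ⟨p, g⟩) (y | ⟨q, g'⟩)
    iterate 3 rfl
    simp only [Cover.lab]
    rw [← oddExtension_neg, neg_sub]
  · rintro (x | ⟨p, g⟩) (y | ⟨q, g'⟩)
    · refine (base_eq _ _).trans ?_
      simp [Cover.pointType, Subtype.ext_iff]
    · refine (base_eq _ _).trans ?_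
      simp only [Cover.pointType, reduceCtorEq, iff_false]
      exact fun h => q.2 (h ▸ x.2)
    · refine (base_eq _ _).trans ?_
      simp only [Cover.pointType, reduceCtorEq, iff_false]
      exact fun h => p.2 (h ▸ y.2)
    · change (oddExtension f (fun q => q.1.out) p q (g' - g)).1 =
        (oddExtension f (fun q => q.1.out) p q (g' - g)).2 ↔ _
      unfold oddExtension
      split_ifs with h₁ h₂
      · refine iff_of_false (hf _ _ _).2.2 ?_
        rintro ⟨⟩
        simp at h₁
      · rw [sub_eq_zero] at h₂
        subst h₂
        simp [Subtype.ext_iff]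
      · refine iff_of_false (hf _ _ _).2.2.symm ?_
        rintro ⟨⟩
        simp at h₂
  · intro a
    by_cases ha : Royal S (Quotient.mk (typeSetoid S) a)
    · exact ⟨.inl ⟨_, ha⟩, (type2_out a).symm⟩
    · exact ⟨.inr (⟨_, ha⟩, 0), (type2_out a).symm⟩
  · intro x a b hax
    have hx : x.pointType = Quotient.mk (typeSetoid S) a := by rw [← mk_base, mk_eq_mk, hax]
    by_cases hb : Royal S (Quotient.mk (typeSetoid S) b)
    · refine ⟨.inl ⟨_, hb⟩, ?_⟩
      have : Cover.lab f x (.inl ⟨_, hb⟩) = (x.base, b) := by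
        rcases x with x | x <;> exact Prod.ext rfl (royal_out b hb)
      rw [this]
      exact hS.type2_eq_of_unique_right (royal_unique b hb) hax
    · rcases x with ⟨p, hp⟩ | ⟨⟨p, hp⟩, g⟩ <;> obtain rfl : p = _ := hx
      · refine ⟨.inr (⟨_, hb⟩, 0), Type2.swap ?_⟩
        change Type2 S b a = Type2 S (Quotient.mk _ b).out (Quotient.mk _ a).out
        rw [royal_out a hp]
        exact hS.type2_eq_of_unique_right (royal_unique a hp) (type2_out b).symm
      · by_cases hab : a = b
        · subst hab
          refine ⟨.inr (⟨_, hp⟩, g), ?_⟩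
          simp only [Cover.lab, sub_self, oddExtension_zero]
          exact hax
        · obtain ⟨t, ht, hft⟩ := hsurj ⟨_, hp⟩ ⟨_, hb⟩ a b rfl rfl hab
          refine ⟨.inr (⟨_, hb⟩, g + t), ?_⟩
          simp only [Cover.lab, add_sub_cancel_left, oddExtension_of_pos _ _ _ _ ht, hft]

end Labelling

theorem IsHomog2.exists_isTransitive {L M : Type} [Nonempty M] {S : Str L M} (hS : IsHomog2 S) :
    ∃ (N : Type) (T : Str L N), Nonempty N ∧ IsTransitive T ∧ TwoIsomorphic S T := by
  classical
  obtain ⟨G, _, _, _, e, he, hpos⟩ := exists_pos_embedding (M × M)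
  choose d hd using fun (p q : {q // ¬ Royal S q}) => exists_ne_of_not_royal p.2 q.1
  let P (p q : {q // ¬ Royal S q}) (s : M × M) : Prop :=
    Quotient.mk (typeSetoid S) s.1 = p.1 ∧ Quotient.mk (typeSetoid S) s.2 = q.1 ∧ s.1 ≠ s.2
  let f (p q : {q // ¬ Royal S q}) (g : G) : M × M :=
    if P p q (Function.invFun e g) then Function.invFun e g else d p q
  have hf : ∀ p q g, P p q (f p q g) := by
    intro p q g
    by_cases h : P p q (Function.invFun e g)
    · simpa only [f, if_pos h] using h
    · simpa only [f, if_neg h] using hd p q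
  have hl := Cover.isLabelling hS f hf fun p q a b ha hb hab => by
    refine ⟨e (a, b), hpos _, ?_⟩
    have : P p q (a, b) := ⟨ha, hb, hab⟩
    simp only [f, Function.leftInverse_invFun he (a, b), if_pos this]
  obtain ⟨x, -⟩ := hl.exists_base (Classical.arbitrary M)
  refine ⟨Cover S G, _, ⟨x⟩, hl.isTransitive hS fun x y hxy => ?_, _, _, hl.isTwoIso hS⟩
  refine Cover.exists_translation f x y ?_
  rw [← Quotient.out_eq x.pointType, ← Quotient.out_eq y.pointType]
  exact mk_eq_mk.2 hxy

/-- A binary model `M` is 2-isomorphic to some transitive model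
`N` if and only if `M` is 2-homogeneous. -/
theorem stmt0 (L M : Type) [Nonempty M] (S : Str L M) :
    (∃ (N : Type) (T : Str L N), Nonempty N ∧ IsTransitive T ∧ TwoIsomorphic S T) ↔
      IsHomog2 S := by
  exact ⟨fun ⟨_, _, _, hT, _, _, h⟩ => h.isHomog2 hT, IsHomog2.exists_isTransitive⟩

end AN
end

section
/- Let L be a binary relational language. Every L-structure is 2-equivalent to a transitive L-structure. -/
namespace AN

open Filter

section TypesOfUltrafilters

variable {L M : Type}

/-- Interchange the two variables of an FO2-formula. -/
def swapVars : FO2 L → FO2 L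
  | .eq i j => .eq i.rev j.rev
  | .rel r i j => .rel r i.rev j.rev
  | .not φ => .not (swapVars φ)
  | .and φ ψ => .and (swapVars φ) (swapVars ψ)
  | .ex i φ => .ex i.rev (swapVars φ)

theorem sat_swapVars (S : Str L M) (φ : FO2 L) (v : Fin 2 → M) :
    Sat S (swapVars φ) v ↔ Sat S φ (v ∘ Fin.rev) := by
  induction φ generalizing v with
  | eq i j => rfl
  | rel r i j => rfl
  | not φ ih => simp [swapVars, Sat, ih]
  | and φ ψ ih₁ ih₂ => simp [swapVars, Sat, ih₁, ih₂]
  | ex i φ ih =>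
    simp only [swapVars, Sat, ih]
    refine exists_congr fun m => ?_
    rw [Function.update_comp_eq_of_injective v Fin.rev_injective]

theorem sat2_swapVars (S : Str L M) (φ : FO2 L) (a b : M) :
    Sat2 S (swapVars φ) a b ↔ Sat2 S φ b a := by
  have h : (![a, b] ∘ Fin.rev : Fin 2 → M) = ![b, a] := by
    ext i; fin_cases i <;> rfl
  rw [Sat2, sat_swapVars, h, Sat2]

theorem sat2_ex_zero (S : Str L M) (φ : FO2 L) (a b : M) :
    Sat2 S (.ex 0 φ) a b ↔ ∃ m, Sat2 S φ m b := by
  refine exists_congr fun m => ?_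
  have h : Function.update ![a, b] 0 m = ![m, b] := by
    ext i; fin_cases i <;> rfl
  rw [h, Sat2]

theorem sat2_ex_one (S : Str L M) (φ : FO2 L) (a b : M) :
    Sat2 S (.ex 1 φ) a b ↔ ∃ m, Sat2 S φ a m := by
  refine exists_congr fun m => ?_
  have h : Function.update ![a, b] 1 m = ![a, m] := by
    ext i; fin_cases i <;> rfl
  rw [h, Sat2]

theorem sat_congr_free {V : Type} [DecidableEq V] (S : Str L M) (φ : FOV L V) (v w : V → M)
    (h : ∀ i ∈ Free φ, v i = w i) : Sat S φ v ↔ Sat S φ w := by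
  induction φ generalizing v w with
  | eq i j => simp [Sat, h i (by simp [Free]), h j (by simp [Free])]
  | rel r i j => simp [Sat, h i (by simp [Free]), h j (by simp [Free])]
  | not φ ih => exact not_congr (ih v w h)
  | and φ ψ ih₁ ih₂ =>
    exact and_congr (ih₁ v w fun i hi => h i (Or.inl hi)) (ih₂ v w fun i hi => h i (Or.inr hi))
  | ex i φ ih =>
    refine exists_congr fun m => ih _ _ fun j hj => ?_
    by_cases hij : j = i
    · subst hij; simp
    · simpa [hij] using h j ⟨hj, hij⟩

/-- The 1-type that is the limit along `U` of the types of the elements. -/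
def elemType (S : Str L M) (U : Ultrafilter M) : Set (FO2 L) :=
  {φ | ∀ᶠ m in (U : Filter M), Sat2 S φ m m}

/-- The 2-type that is the limit along `W` of the types of the pairs. -/
def pairType (S : Str L M) (W : Ultrafilter (M × M)) : Set (FO2 L) :=
  {φ | ∀ᶠ z in (W : Filter (M × M)), Sat2 S φ z.1 z.2}

theorem pairType_swap_congr {S : Str L M} {W W' : Ultrafilter (M × M)}
    (h : pairType S W = pairType S W') :
    pairType S (W.map Prod.swap) = pairType S (W'.map Prod.swap) := by
  have key : ∀ (V : Ultrafilter (M × M)) (φ : FO2 L),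
      φ ∈ pairType S (V.map Prod.swap) ↔ swapVars φ ∈ pairType S V := fun V φ =>
    eventually_congr (Eventually.of_forall fun z => (sat2_swapVars S φ z.1 z.2).symm)
  ext φ
  rw [key, key, h]

theorem eq_pure_of_singleton_mem {U : Ultrafilter M} {c : M} (h : {c} ∈ U) : U = pure c :=
  Ultrafilter.eq_of_le (Filter.le_pure_iff.2 h)

/-- The element `c` is the only one satisfying some FO2-formula. -/
def IsKing (S : Str L M) (c : M) : Prop := ∃ φ : FO2 L, ∀ m, Sat2 S φ m m ↔ m = c

theorem IsKing.eq_pure {S : Str L M} {c : M} (hc : IsKing S c) {U : Ultrafilter M}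
    (h : elemType S U = elemType S (pure c)) : U = pure c := by
  obtain ⟨φ, hφ⟩ := hc
  have h₁ : φ ∈ elemType S (pure c) := by
    change ∀ᶠ m in (pure c : Filter M), Sat2 S φ m m
    simp [hφ]
  rw [← h] at h₁
  have h₂ : ({c} : Set M) ∈ U := by
    refine Filter.mem_of_superset h₁ fun m hm => (hφ m).1 hm
  exact eq_pure_of_singleton_mem h₂

theorem IsKing.pairType_congr {S : Str L M} {c : M} (hc : IsKing S c) {U V : Ultrafilter M}
    (h : elemType S U = elemType S V) :
    pairType S (U.map fun m => (m, c)) = pairType S (V.map fun m => (m, c)) := by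
  obtain ⟨φ, hφ⟩ := hc
  have key : ∀ (U : Ultrafilter M) (ψ : FO2 L), ψ ∈ pairType S (U.map fun m => (m, c)) ↔
      .ex 1 (.and (.ex 0 (.and (.eq 0 1) φ)) ψ) ∈ elemType S U := by
    intro U ψ
    refine eventually_congr (Eventually.of_forall fun m => ?_)
    have h₀ : ∀ b : M, Sat2 S (.ex 0 (.and (.eq 0 1) φ)) m b ↔ b = c := by
      intro b
      rw [sat2_ex_zero, ← hφ b]
      constructor
      · rintro ⟨x, hx, hx'⟩
        have : x = b := hx
        exact this ▸ hx'
      · exact fun hb => ⟨b, rfl, hb⟩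
    rw [sat2_ex_one]
    constructor
    · exact fun hm => ⟨c, (h₀ c).2 rfl, hm⟩
    · rintro ⟨b, hb, hb'⟩
      have : b = c := (h₀ b).1 hb
      exact this ▸ hb'
  ext ψ
  rw [key, key, h]

theorem eq_map_of_map_snd_eq_pure {W : Ultrafilter (M × M)} {c : M}
    (h : W.map Prod.snd = pure c) : W = (W.map Prod.fst).map fun m => (m, c) := by
  have h₁ : ∀ᶠ z in (W : Filter (M × M)), z.2 = c := by
    have : ({c} : Set M) ∈ W.map Prod.snd := by rw [h]; exact Set.mem_singleton c
    exact this
  refine Ultrafilter.coe_injective ?_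
  rw [Ultrafilter.coe_map, Ultrafilter.coe_map, Filter.map_map]
  conv_lhs => rw [← Filter.map_id (f := (W : Filter (M × M)))]
  refine Filter.map_congr ?_
  filter_upwards [h₁] with z hz
  exact Prod.ext rfl hz

/-- `W` is a limit of pairs of distinct elements, with coordinates of types `p` and `q`. -/
def Good (S : Str L M) (p q : Set (FO2 L)) (W : Ultrafilter (M × M)) : Prop :=
  elemType S (W.map Prod.fst) = p ∧ elemType S (W.map Prod.snd) = q ∧
    ∀ᶠ z in (W : Filter (M × M)), z.1 ≠ z.2

theorem Good.swap {S : Str L M} {p q : Set (FO2 L)} {W : Ultrafilter (M × M)}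
    (h : Good S p q W) : Good S q p (W.map Prod.swap) :=
  ⟨h.2.1, h.1, h.2.2.mono fun _ hz => hz.symm⟩

/-- The filter generated by the sets definable by a formula of the type of `U`. -/
def typeFilter (S : Str L M) (U : Ultrafilter M) : Filter M where
  sets := {s | ∃ φ ∈ elemType S U, ∀ m, Sat2 S φ m m → m ∈ s}
  univ_sets := ⟨.eq 0 0, Eventually.of_forall fun _ => rfl, fun _ _ => trivial⟩
  sets_of_superset := by
    rintro s t ⟨φ, hφ, h⟩ hst
    exact ⟨φ, hφ, fun m hm => hst (h m hm)⟩
  inter_sets := by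
    rintro s t ⟨φ, hφ, h⟩ ⟨ψ, hψ, h'⟩
    exact ⟨.and φ ψ, hφ.and hψ, fun m hm => ⟨h m hm.1, h' m hm.2⟩⟩

theorem elemType_eq_of_le {S : Str L M} {U V : Ultrafilter M}
    (h : (V : Filter M) ≤ typeFilter S U) : elemType S V = elemType S U := by
  have key : ∀ φ ∈ elemType S U, φ ∈ elemType S V := fun φ hφ => h ⟨φ, hφ, fun _ hm => hm⟩
  refine Set.Subset.antisymm (fun φ hφ => ?_) key
  by_contra hn
  have h₁ : FOV.not φ ∈ elemType S U := Ultrafilter.eventually_not.2 hn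
  exact Ultrafilter.eventually_not.1 (key _ h₁) hφ

theorem exists_good {S : Str L M} (U V : Ultrafilter M)
    (hU : ∀ c, IsKing S c → elemType S U ≠ elemType S (pure c)) :
    ∃ W, Good S (elemType S U) (elemType S V) W := by
  have hne : (typeFilter S U ×ˢ typeFilter S V ⊓ 𝓟 {z : M × M | z.1 ≠ z.2}).NeBot := by
    rw [Filter.inf_principal_neBot_iff]
    intro s hs
    obtain ⟨A, ⟨φ, hφ, hA⟩, B, ⟨ψ, hψ, hB⟩, hAB⟩ := Filter.mem_prod_iff.1 hs
    by_contra hemp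
    have heq : ∀ a b, Sat2 S φ a a → Sat2 S ψ b b → a = b := by
      intro a b ha hb
      by_contra hab
      exact hemp ⟨(a, b), hAB ⟨hA a ha, hB b hb⟩, hab⟩
    obtain ⟨c, hc⟩ := Filter.Eventually.exists hψ
    have hking : IsKing S c := by
      obtain ⟨a, ha⟩ := Filter.Eventually.exists hφ
      exact ⟨φ, fun m => ⟨fun hm => heq m c hm hc, fun hm => hm ▸ heq a c ha hc ▸ ha⟩⟩
    have hmem : ({c} : Set M) ∈ U :=
      Filter.mem_of_superset hφ fun m hm => heq m c hm hc
    have : U = pure c := eq_pure_of_singleton_mem hmem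
    exact hU c hking (by rw [this])
  have hle := Ultrafilter.of_le (typeFilter S U ×ˢ typeFilter S V ⊓ 𝓟 {z : M × M | z.1 ≠ z.2})
  refine ⟨Ultrafilter.of (typeFilter S U ×ˢ typeFilter S V ⊓ 𝓟 {z : M × M | z.1 ≠ z.2}),
    elemType_eq_of_le ?_, elemType_eq_of_le ?_, ?_⟩
  · exact (Filter.map_mono (hle.trans inf_le_left)).trans Filter.tendsto_fst
  · exact (Filter.map_mono (hle.trans inf_le_left)).trans Filter.tendsto_snd
  · exact Filter.le_principal_iff.1 (hle.trans inf_le_right)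

end TypesOfUltrafilters

section Labellings

variable {L M N : Type}

/-- A labelling of the pairs of elements of `N` by limits of pairs of elements of `S`,
coherent and rich enough for the labels to be the 2-types of a structure on `N`. -/
structure IsLabelling_s1 (S : Str L M) (t : N → N → Ultrafilter (M × M))
    (τ : N → Set (FO2 L)) : Prop where
  swap : ∀ a b, t b a = (t a b).map Prod.swap
  fst : ∀ a b, elemType S ((t a b).map Prod.fst) = τ a
  diag : ∀ a b, (∀ᶠ z in (t a b : Filter (M × M)), z.1 = z.2) ↔ a = b
  forth : ∀ a W, elemType S (W.map Prod.fst) = τ a → ∃ b, pairType S (t a b) = pairType S W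

/-- The structure determined by a labelling of pairs. -/
def limitStr (S : Str L M) (t : N → N → Ultrafilter (M × M)) : Str L N :=
  fun r a b => ∀ᶠ z in (t a b : Filter (M × M)), S r z.1 z.2

variable {S : Str L M} {t : N → N → Ultrafilter (M × M)} {τ : N → Set (FO2 L)}

theorem IsLabelling_s1.snd (h : IsLabelling_s1 S t τ) (a b : N) :
    elemType S ((t a b).map Prod.snd) = τ b := by
  rw [← h.fst b a, h.swap a b]; rfl

theorem IsLabelling_s1.mem_iff_self (h : IsLabelling_s1 S t τ) (a : N) (φ : FO2 L) :
    φ ∈ τ a ↔ φ ∈ pairType S (t a a) := by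
  rw [← h.fst a a]
  refine eventually_congr ?_
  filter_upwards [(h.diag a a).2 rfl] with z hz
  rw [← hz]

theorem IsLabelling_s1.limitStr_self (h : IsLabelling_s1 S t τ) (r : L) (a : N) :
    limitStr S t r a a ↔ FOV.rel r 0 0 ∈ τ a := by
  rw [h.mem_iff_self]
  refine eventually_congr ?_
  filter_upwards [(h.diag a a).2 rfl] with z hz
  simp [Sat2, Sat, hz]

theorem IsLabelling_s1.sat2_iff (h : IsLabelling_s1 S t τ) (φ : FO2 L) (a b : N) :
    Sat2 (limitStr S t) φ a b ↔ φ ∈ pairType S (t a b) := by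
  induction φ generalizing a b with
  | eq i j =>
    fin_cases i <;> fin_cases j
    · simp [Sat2, Sat, pairType]
    · exact (h.diag a b).symm
    · refine eq_comm.trans ((h.diag a b).symm.trans ?_)
      exact eventually_congr (Eventually.of_forall fun z => eq_comm)
    · simp [Sat2, Sat, pairType]
  | rel r i j =>
    fin_cases i <;> fin_cases j
    · refine (h.limitStr_self r a).trans ?_
      rw [← h.fst a b]; rfl
    · rfl
    · change limitStr S t r b a ↔ _
      rw [limitStr, h.swap a b]; rfl
    · refine (h.limitStr_self r b).trans ?_
      rw [← h.snd a b]; rfl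
  | not φ ih => exact (not_congr (ih a b)).trans Ultrafilter.eventually_not.symm
  | and φ ψ ih₁ ih₂ => exact (and_congr (ih₁ a b) (ih₂ a b)).trans eventually_and.symm
  | ex i φ ih =>
    have : Nonempty M := (t a b).neBot.nonempty.map Prod.fst
    obtain rfl | rfl : i = 0 ∨ i = 1 := by fin_cases i <;> simp
    · rw [sat2_ex_zero]
      have hτ : FOV.ex 0 φ ∈ pairType S (t a b) ↔ FOV.ex 0 φ ∈ τ b := by
        rw [← h.snd a b]
        exact eventually_congr (Eventually.of_forall fun z =>
          (sat2_ex_zero ..).trans (sat2_ex_zero ..).symm)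
      constructor
      · rintro ⟨a', ha'⟩
        rw [hτ, ← h.snd a' b]
        exact ((ih a' b).1 ha').mono fun z hz => (sat2_ex_zero ..).2 ⟨z.1, hz⟩
      · intro hex
        have hex' : ∀ᶠ z in (t a b : Filter (M × M)), ∃ m, Sat2 S φ m z.2 :=
          hex.mono fun z hz => (sat2_ex_zero ..).1 hz
        obtain ⟨f, hf⟩ : ∃ f : M → M, ∀ y, (∃ m, Sat2 S φ m y) → Sat2 S φ (f y) y := by
          refine ⟨fun y => Classical.epsilon fun m => Sat2 S φ m y, fun y hy => ?_⟩
          exact Classical.epsilon_spec hy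
        obtain ⟨a', ha'⟩ := h.forth b ((t a b).map fun z : M × M => (z.2, f z.2)) (h.snd a b)
        refine ⟨a', (ih a' b).2 ?_⟩
        rw [h.swap b a', pairType_swap_congr ha']
        exact hex'.mono fun z hz => hf z.2 hz
    · rw [sat2_ex_one]
      have hτ : FOV.ex 1 φ ∈ pairType S (t a b) ↔ FOV.ex 1 φ ∈ τ a := by
        rw [← h.fst a b]
        exact eventually_congr (Eventually.of_forall fun z =>
          (sat2_ex_one ..).trans (sat2_ex_one ..).symm)
      constructor
      · rintro ⟨b', hb'⟩
        rw [hτ, ← h.fst a b']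
        exact ((ih a b').1 hb').mono fun z hz => (sat2_ex_one ..).2 ⟨z.2, hz⟩
      · intro hex
        have hex' : ∀ᶠ z in (t a b : Filter (M × M)), ∃ m, Sat2 S φ z.1 m :=
          hex.mono fun z hz => (sat2_ex_one ..).1 hz
        obtain ⟨f, hf⟩ : ∃ f : M → M, ∀ x, (∃ m, Sat2 S φ x m) → Sat2 S φ x (f x) := by
          refine ⟨fun x => Classical.epsilon fun m => Sat2 S φ x m, fun x hx => ?_⟩
          exact Classical.epsilon_spec hx
        obtain ⟨b', hb'⟩ := h.forth a ((t a b).map fun z : M × M => (z.1, f z.1)) (h.fst a b)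
        refine ⟨b', (ih a b').2 ?_⟩
        rw [hb']
        exact hex'.mono fun z hz => hf z.1 hz

theorem IsLabelling_s1.equiv2 [Nonempty N] (h : IsLabelling_s1 S t τ) : Equiv2 S (limitStr S t) := by
  intro φ hφ
  constructor
  · intro hS v
    have hv : v = ![v 0, v 1] := by ext i; fin_cases i <;> rfl
    rw [hv]
    exact (h.sat2_iff φ _ _).2 (Eventually.of_forall fun z => hS _)
  · intro hT v
    obtain ⟨a⟩ := ‹Nonempty N›
    obtain ⟨z, hz⟩ := Filter.Eventually.exists ((h.sat2_iff φ a a).1 (hT _))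
    refine (sat_congr_free S φ _ _ fun i hi => ?_).1 hz
    rw [Sentence] at hφ
    simp [hφ] at hi

theorem IsLabelling_s1.isTransitive (h : IsLabelling_s1 S t τ)
    (hτ : ∀ a b, τ a = τ b → ∃ f : N ≃ N, (∀ x y, t (f x) (f y) = t x y) ∧ f a = b) :
    IsTransitive (limitStr S t) := by
  intro a b hab
  obtain ⟨f, hf, hfa⟩ := hτ a b (by
    ext φ
    rw [h.mem_iff_self, h.mem_iff_self, ← h.sat2_iff, ← h.sat2_iff]
    exact Set.ext_iff.1 hab φ)
  exact ⟨f, fun r x y => by rw [limitStr, limitStr, hf], hfa⟩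

end Labellings

section Construction

variable {L M : Type}

/-- Every type is the image of the positive cone of some linearly ordered abelian group. -/
theorem exists_orderedGroup_surjection (α : Type) [Nonempty α] :
    ∃ (G : Type) (_ : AddCommGroup G) (_ : LinearOrder G) (_ : IsOrderedAddMonoid G)
      (dec : G → α), ∀ w, ∃ g, 0 < g ∧ dec g = w := by
  classical
  let _ : LinearOrder α := linearOrderOfSTO WellOrderingRel
  refine ⟨Lex (α →₀ ℤ), inferInstance, inferInstance, inferInstance,
    Function.invFun fun w => toLex (Finsupp.single w 1), fun w => ⟨_, ?_,
      Function.leftInverse_invFun ?_ w⟩⟩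
  · rw [Finsupp.Lex.lt_iff]
    refine ⟨w, fun j hj => ?_, ?_⟩
    · simp [hj.ne']
    · simp
  · intro a b hab
    exact (Finsupp.single_left_injective one_ne_zero) (toLex.injective hab)

/-- The 1-types of `S` that are not realized by a king. -/
def CommonerType (S : Str L M) : Type :=
  {p : Set (FO2 L) // (∃ U, elemType S U = p) ∧ ∀ c, IsKing S c → p ≠ elemType S (pure c)}

/-- An ultrafilter with a given type as its limit type. -/
noncomputable def CommonerType.lim {S : Str L M} (p : CommonerType S) : Ultrafilter M :=
  p.2.1.choose

theorem CommonerType.elemType_lim {S : Str L M} (p : CommonerType S) :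
    elemType S p.lim = p.1 :=
  p.2.1.choose_spec

theorem exists_commoner_labels (S : Str L M) (G : Type) [AddCommGroup G] [LinearOrder G]
    [IsOrderedAddMonoid G] (dec : G → Ultrafilter (M × M))
    (hdec : ∀ w, ∃ g, 0 < g ∧ dec g = w) :
    ∃ F : CommonerType S → CommonerType S → G → Ultrafilter (M × M),
      (∀ p q d, F q p (-d) = (F p q d).map Prod.swap) ∧
      (∀ p q d, elemType S ((F p q d).map Prod.fst) = p.1) ∧
      (∀ p q d, (∀ᶠ z in (F p q d : Filter (M × M)), z.1 = z.2) ↔ p = q ∧ d = 0) ∧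
      ∀ p q W, Good S p.1 q.1 W → ∃ d, F p q d = W := by
  classical
  let _ : LinearOrder (CommonerType S) := linearOrderOfSTO WellOrderingRel
  have hgood : ∀ p q : CommonerType S, ∃ W, Good S p.1 q.1 W := by
    intro p q
    rw [← p.elemType_lim, ← q.elemType_lim]
    exact exists_good _ _ (by rw [p.elemType_lim]; exact p.2.2)
  choose W₀ hW₀ using hgood
  let E : CommonerType S → CommonerType S → G → Ultrafilter (M × M) := fun p q d =>
    if Good S p.1 q.1 (dec d) then dec d else W₀ p q
  have hE : ∀ p q d, Good S p.1 q.1 (E p q d) := by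
    intro p q d
    by_cases hd : Good S p.1 q.1 (dec d)
    · simp [E, hd]
    · simpa [E, hd] using hW₀ p q
  let pos : CommonerType S → CommonerType S → G → Prop := fun p q d => 0 < d ∨ d = 0 ∧ p < q
  let F : CommonerType S → CommonerType S → G → Ultrafilter (M × M) := fun p q d =>
    if pos p q d then E p q d else
      if pos q p (-d) then (E q p (-d)).map Prod.swap else p.lim.map fun m => (m, m)
  have tri : ∀ p q d, (pos p q d ∧ ¬ pos q p (-d)) ∨ (¬ pos p q d ∧ pos q p (-d)) ∨
      (p = q ∧ d = 0) := by
    intro p q d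
    simp only [pos, Left.neg_pos_iff, neg_eq_zero]
    rcases lt_trichotomy d 0 with hd | hd | hd
    · simp [hd, hd.ne, hd.not_gt]
    · subst hd
      rcases lt_trichotomy p q with hp | hp | hp
      · simp [hp, hp.not_gt]
      · simp [hp]
      · simp [hp, hp.not_gt]
    · simp [hd, hd.ne', hd.not_gt]
  have npos : ∀ p, ¬ pos p p 0 := by simp [pos]
  have F₁ : ∀ p q d, pos p q d → F p q d = E p q d := fun p q d h => by simp [F, h]
  have F₂ : ∀ p q d, ¬ pos p q d → pos q p (-d) → F p q d = (E q p (-d)).map Prod.swap :=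
    fun p q d h h' => by simp [F, h, h']
  have F₃ : ∀ p, F p p 0 = p.lim.map fun m => (m, m) := fun p => by simp [F, npos]
  have hF : ∀ p q d, Good S p.1 q.1 (F p q d) ∨ (p = q ∧ d = 0) := by
    intro p q d
    rcases tri p q d with ⟨h, -⟩ | ⟨h, h'⟩ | h
    · exact Or.inl (F₁ p q d h ▸ hE p q d)
    · exact Or.inl (F₂ p q d h h' ▸ (hE q p (-d)).swap)
    · exact Or.inr h
  refine ⟨F, fun p q d => ?_, fun p q d => ?_, fun p q d => ?_, fun p q W hW => ?_⟩
  · rcases tri p q d with ⟨h, h'⟩ | ⟨h, h'⟩ | ⟨rfl, rfl⟩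
    · rw [F₁ p q d h, F₂ q p (-d) h' (by rwa [neg_neg]), neg_neg]
    · rw [F₁ q p (-d) h', F₂ p q d h h', Ultrafilter.map_map, Prod.swap_swap_eq,
        Ultrafilter.map_id]
    · rw [neg_zero, F₃, Ultrafilter.map_map]; rfl
  · rcases hF p q d with h | ⟨rfl, rfl⟩
    · exact h.1
    · rw [F₃, Ultrafilter.map_map, ← p.elemType_lim]; rfl
  · constructor
    · intro hz
      rcases hF p q d with h | h
      · obtain ⟨z, hz₁, hz₂⟩ := (hz.and h.2.2).exists
        exact absurd hz₁ hz₂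
      · exact h
    · rintro ⟨rfl, rfl⟩
      rw [F₃]
      exact Eventually.of_forall (f := (p.lim : Filter M)) fun m => rfl
  · obtain ⟨d, hd, rfl⟩ := hdec W
    exact ⟨d, by rw [F₁ p q d (Or.inl hd)]; simp [E, hW]⟩

theorem pairType_diagonal_congr {S : Str L M} {W W' : Ultrafilter (M × M)}
    (h : elemType S (W.map Prod.fst) = elemType S (W'.map Prod.fst))
    (hW : ∀ᶠ z in (W : Filter (M × M)), z.1 = z.2)
    (hW' : ∀ᶠ z in (W' : Filter (M × M)), z.1 = z.2) : pairType S W = pairType S W' := by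
  have key : ∀ V : Ultrafilter (M × M), (∀ᶠ z in (V : Filter (M × M)), z.1 = z.2) →
      pairType S V = elemType S (V.map Prod.fst) := by
    intro V hV
    ext φ
    refine eventually_congr ?_
    filter_upwards [hV] with z hz
    rw [← hz]
  rw [key W hW, key W' hW', h]

theorem exists_transitive_labelling (S : Str L M) [Nonempty M] :
    ∃ (N : Type) (t : N → N → Ultrafilter (M × M)) (τ : N → Set (FO2 L)), Nonempty N ∧
      IsLabelling_s1 S t τ ∧
      ∀ a b, τ a = τ b → ∃ f : N ≃ N, (∀ x y, t (f x) (f y) = t x y) ∧ f a = b := by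
  classical
  have : Nonempty (Ultrafilter (M × M)) := ‹Nonempty M›.map fun m => pure (m, m)
  obtain ⟨G, _, _, _, dec, hdec⟩ := exists_orderedGroup_surjection (Ultrafilter (M × M))
  obtain ⟨F, Fswap, Ffst, Fdiag, Fgood⟩ := exists_commoner_labels S G dec hdec
  let N := {c : M // IsKing S c} ⊕ (CommonerType S × G)
  let t : N → N → Ultrafilter (M × M)
    | .inl c, .inl c' => pure (c.1, c'.1)
    | .inl c, .inr q => q.1.lim.map fun m => (c.1, m)
    | .inr p, .inl c => p.1.lim.map fun m => (m, c.1)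
    | .inr p, .inr q => F p.1 q.1 (q.2 - p.2)
  let τ : N → Set (FO2 L)
    | .inl c => elemType S (pure c.1)
    | .inr p => p.1.1
  have classify : ∀ U : Ultrafilter M, (∃ c, IsKing S c ∧ U = pure c) ∨
      ∃ p : CommonerType S, p.1 = elemType S U := by
    intro U
    by_cases hU : ∃ c, IsKing S c ∧ elemType S U = elemType S (pure c)
    · obtain ⟨c, hc, h⟩ := hU
      exact Or.inl ⟨c, hc, hc.eq_pure h⟩
    · push Not at hU
      exact Or.inr ⟨⟨elemType S U, ⟨U, rfl⟩, hU⟩, rfl⟩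
  have apart : ∀ (p : CommonerType S) (c : M), IsKing S c →
      ¬ ∀ᶠ m in (p.lim : Filter M), m = c := by
    intro p c hc h
    have hmem : ({c} : Set M) ∈ p.lim := h
    have : p.lim = pure c := eq_pure_of_singleton_mem hmem
    exact p.2.2 c hc (by rw [← this, p.elemType_lim])
  have hswap : ∀ a b, t b a = (t a b).map Prod.swap := by
    rintro (c | p) (c' | q)
    · rfl
    · rfl
    · rfl
    · change F q.1 p.1 (p.2 - q.2) = _
      rw [← neg_sub, Fswap]
  refine ⟨N, t, τ, ?_, ⟨hswap, ?_, ?_, ?_⟩, ?_⟩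
  · obtain ⟨m⟩ := ‹Nonempty M›
    rcases classify (pure m) with ⟨c, hc, -⟩ | ⟨p, -⟩
    · exact ⟨.inl ⟨c, hc⟩⟩
    · exact ⟨.inr (p, 0)⟩
  · rintro (c | p) (c' | q)
    · rfl
    · change elemType S ((q.1.lim.map fun m => (c.1, m)).map Prod.fst) = elemType S (pure c.1)
      ext φ
      simp [elemType, Ultrafilter.map_map]
    · exact p.1.elemType_lim
    · exact Ffst _ _ _
  · rintro (c | p) (c' | q)
    · change (∀ᶠ z in (pure (c.1, c'.1) : Filter (M × M)), z.1 = z.2) ↔ _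
      rw [Filter.eventually_pure, Sum.inl.injEq, Subtype.ext_iff]
    · refine iff_of_false (fun h => ?_) Sum.inl_ne_inr
      exact apart q.1 c.1 c.2 (Filter.Eventually.mono h fun _ h => h.symm)
    · exact iff_of_false (apart p.1 c'.1 c'.2) Sum.inr_ne_inl
    · refine (Fdiag _ _ _).trans ?_
      rw [Sum.inr.injEq, Prod.ext_iff, sub_eq_zero]
      exact and_congr_right fun _ => eq_comm
  · rintro (c | p) W hW
    · have hc : W.map Prod.fst = pure c.1 := c.2.eq_pure hW
      have hW' : W.map Prod.swap = (W.map Prod.snd).map fun m => (m, c.1) :=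
        eq_map_of_map_snd_eq_pure (W := W.map Prod.swap) hc
      have hWW : W = (W.map Prod.swap).map Prod.swap := by
        rw [Ultrafilter.map_map, Prod.swap_swap_eq, Ultrafilter.map_id]
      rcases classify (W.map Prod.snd) with ⟨c', hc', h⟩ | ⟨q, hq⟩
      · refine ⟨.inl ⟨c', hc'⟩, ?_⟩
        rw [hWW, hW', h]
        rfl
      · refine ⟨.inr (q, 0), ?_⟩
        rw [hWW, hW', hswap (.inr (q, 0)) (.inl c)]
        exact pairType_swap_congr (c.2.pairType_congr (q.elemType_lim.trans hq))
    · by_cases hd : ∀ᶠ z in (W : Filter (M × M)), z.1 = z.2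
      · refine ⟨.inr p, pairType_diagonal_congr ((Ffst _ _ _).trans hW.symm) ?_ hd⟩
        exact (Fdiag _ _ _).2 ⟨rfl, sub_self _⟩
      · rcases classify (W.map Prod.snd) with ⟨c, hc, h⟩ | ⟨q, hq⟩
        · refine ⟨.inl ⟨c, hc⟩, ?_⟩
          rw [eq_map_of_map_snd_eq_pure h]
          exact hc.pairType_congr (p.1.elemType_lim.trans hW.symm)
        · obtain ⟨d, hd'⟩ := Fgood p.1 q W ⟨hW, hq.symm, Ultrafilter.eventually_not.2 hd⟩
          refine ⟨.inr (q, p.2 + d), ?_⟩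
          change pairType S (F p.1 q (p.2 + d - p.2)) = _
          rw [add_sub_cancel_left, hd']
  · rintro (c | ⟨p, g⟩) (c' | ⟨q, h⟩) hab
    · refine ⟨Equiv.refl _, fun _ _ => rfl, ?_⟩
      have hcc : (pure c.1 : Ultrafilter M) = pure c'.1 := c'.2.eq_pure hab
      exact congrArg Sum.inl (Subtype.ext (Ultrafilter.pure_injective hcc))
    · exact absurd hab.symm (q.2.2 c.1 c.2)
    · exact absurd hab (p.2.2 c'.1 c'.2)
    · obtain rfl : p = q := Subtype.ext hab
      refine ⟨Equiv.sumCongr (Equiv.refl _)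
        (Equiv.prodCongr (Equiv.refl _) (Equiv.addRight (h - g))), ?_, ?_⟩
      · rintro (c | p) (c' | q)
        · rfl
        · rfl
        · rfl
        · change F p.1 q.1 (q.2 + (h - g) - (p.2 + (h - g))) = F p.1 q.1 (q.2 - p.2)
          rw [add_sub_add_right_eq_sub]
      · change Sum.inr (p, g + (h - g)) = _
        rw [add_sub_cancel]

end Construction

/-- Every binary model is 2-equivalent to a transitive model. -/
theorem stmt1 (L M : Type) [Nonempty M] (S : Str L M) :
    ∃ (N : Type) (T : Str L N), Nonempty N ∧ IsTransitive T ∧ Equiv2 S T := by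
  obtain ⟨N, t, τ, hN, ht, hτ⟩ := exists_transitive_labelling S
  exact ⟨N, limitStr S t, hN, ht.isTransitive hτ, ht.equiv2⟩

end AN
end

section
/- There exist a binary relational language L with exactly four binary relation symbols and a finite L-structure M with 45 elements such that M is not 3-equivalent to any transitive L-structure. -/
namespace AN

/-- The class of an element of `Fin 45`: twenty-one classes of size two and one of size three. -/
def cls (a : Fin 45) : ℕ := min (a.val / 2) 21

/-- The structure interpreting every symbol as the equivalence relation of having the same class. -/
def clsStr : Str (Fin 4) (Fin 45) := fun _ a b => cls a = cls b

lemma exists_ne_cls_eq (a : Fin 45) : ∃ b, a ≠ b ∧ cls a = cls b := by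
  revert a; unfold cls; decide

lemma exists_cls_ne (a : Fin 45) : ∃ b, cls a ≠ cls b := by
  by_cases h : cls a = cls 0
  · exact ⟨2, by rw [h]; decide⟩
  · exact ⟨0, h⟩

lemma clsStr_extend (a b m : Fin 45) :
    ∃ n, (a = m ↔ b = n) ∧ (cls a = cls m ↔ cls b = cls n) := by
  by_cases h : a = m
  · exact ⟨b, by simp [h]⟩
  · by_cases hc : cls a = cls m
    · obtain ⟨n, hn, hcn⟩ := exists_ne_cls_eq b
      exact ⟨n, by simp [h, hn], by simp [hc, hcn]⟩
    · obtain ⟨n, hn⟩ := exists_cls_ne b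
      exact ⟨n, by simp only [h, false_iff]; rintro rfl; exact hn rfl, by simp [hc, hn]⟩

/-- The atomic diagram of a pair determines its 2-type in `clsStr`. -/
lemma sat_clsStr_iff (φ : FO2 (Fin 4)) : ∀ v w : Fin 2 → Fin 45,
    (v 0 = v 1 ↔ w 0 = w 1) → (cls (v 0) = cls (v 1) ↔ cls (w 0) = cls (w 1)) →
    (Sat clsStr φ v ↔ Sat clsStr φ w) := by
  induction φ with
  | eq i j =>
    intro v w h hc
    fin_cases i <;> fin_cases j <;> simp [Sat, h, eq_comm (a := v 1), eq_comm (a := w 1)]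
  | rel r i j =>
    intro v w h hc
    fin_cases i <;> fin_cases j <;>
      simp [Sat, clsStr, hc, eq_comm (a := cls (v 1)), eq_comm (a := cls (w 1))]
  | not φ ih =>
    intro v w h hc
    simp only [Sat, ih v w h hc]
  | and φ ψ ih₁ ih₂ =>
    intro v w h hc
    simp only [Sat, ih₁ v w h hc, ih₂ v w h hc]
  | ex i φ ih =>
    have forth : ∀ v w : Fin 2 → Fin 45, Sat clsStr (.ex i φ) v → Sat clsStr (.ex i φ) w := by
      rintro v w ⟨m, hm⟩
      obtain ⟨n, hn, hcn⟩ := clsStr_extend (v (1 - i)) (w (1 - i)) m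
      refine ⟨n, (ih _ _ ?_ ?_).1 hm⟩
      · fin_cases i <;> simpa [Function.update, eq_comm] using hn
      · fin_cases i <;> simpa [Function.update, eq_comm] using hcn
    exact fun v w _ _ => ⟨forth v w, forth w v⟩

/-- The inclusion of FO2 into FO3. -/
def FOV.toFO3 {L : Type} : FO2 L → FO3 L
  | .eq i j => .eq i.castSucc j.castSucc
  | .rel r i j => .rel r i.castSucc j.castSucc
  | .not φ => .not φ.toFO3
  | .and φ ψ => .and φ.toFO3 ψ.toFO3
  | .ex i φ => .ex i.castSucc φ.toFO3

lemma sat_toFO3 {L M : Type} (S : Str L M) (φ : FO2 L) :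
    ∀ v : Fin 3 → M, Sat S φ.toFO3 v ↔ Sat S φ (v ∘ Fin.castSucc) := by
  induction φ with
  | eq i j => intro v; rfl
  | rel r i j => intro v; rfl
  | not φ ih => intro v; simp only [FOV.toFO3, Sat, ih]
  | and φ ψ ih₁ ih₂ => intro v; simp only [FOV.toFO3, Sat, ih₁, ih₂]
  | ex i φ ih =>
    intro v
    simp only [FOV.toFO3, Sat, ih,
      Function.update_comp_eq_of_injective v (Fin.castSucc_injective 2)]

lemma diff_variables_eq_empty (X : Set (Fin 3)) : ((X \ {2}) \ {1}) \ {0} = ∅ := by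
  ext i; fin_cases i <;> simp

/-- The sentence saying that `φ` holds on the whole diagonal. -/
def diagonalSentence {L : Type} (φ : FO2 L) : FO3 L :=
  .not (.ex 0 (.ex 1 (.ex 2 (.and (.eq 0 1) (.not φ.toFO3)))))

lemma sentence_diagonalSentence {L : Type} (φ : FO2 L) : Sentence (diagonalSentence φ) :=
  diff_variables_eq_empty _

lemma sat_diagonalSentence {L M : Type} (S : Str L M) (φ : FO2 L) (v : Fin 3 → M) :
    Sat S (diagonalSentence φ) v ↔ ∀ a, Sat2 S φ a a := by
  have key : ∀ a b c : M, (Function.update (Function.update (Function.update v 0 a) 1 b) 2 c) ∘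
      Fin.castSucc = ![a, b] := by
    intro a b c; funext i; fin_cases i <;> simp [Function.update]
  simp only [diagonalSentence, Sat, sat_toFO3, key, Sat2]
  simp only [Function.update]
  constructor
  · intro h a
    by_contra ha
    exact h ⟨a, a, a, by simp, ha⟩
  · rintro h ⟨a, b, c, hab, hn⟩
    obtain rfl : a = b := by simpa using hab
    exact hn (h a)

/-- The element `x` is related to two distinct further elements. -/
def twoOthers : FO3 (Fin 4) :=
  .ex 1 (.ex 2 (.and (.and (.rel 0 0 1) (.rel 0 0 2))
    (.and (.not (.eq 0 1)) (.and (.not (.eq 0 2)) (.not (.eq 1 2))))))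

/-- The semantic counterpart of `twoOthers`. -/
def HasTwoOthers {M : Type} (S : Str (Fin 4) M) (a : M) : Prop :=
  ∃ b c, (S 0 a b ∧ S 0 a c) ∧ a ≠ b ∧ a ≠ c ∧ b ≠ c

lemma sat_twoOthers {M : Type} (S : Str (Fin 4) M) (v : Fin 3 → M) (a : M) :
    Sat S twoOthers (Function.update v 0 a) ↔ HasTwoOthers S a := by
  simp [twoOthers, Sat, HasTwoOthers, Function.update]

lemma HasTwoOthers.map {M : Type} {S : Str (Fin 4) M} {f : M ≃ M} (hf : IsAuto S f) {a : M} :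
    HasTwoOthers S a → HasTwoOthers S (f a) := by
  rintro ⟨b, c, ⟨h₁, h₂⟩, h₃, h₄, h₅⟩
  exact ⟨f b, f c, ⟨(hf _ _ _).1 h₁, (hf _ _ _).1 h₂⟩, f.injective.ne h₃, f.injective.ne h₄,
    f.injective.ne h₅⟩

lemma hasTwoOthers_clsStr : HasTwoOthers clsStr 42 :=
  ⟨43, 44, by simp only [clsStr]; decide, by decide⟩

lemma not_hasTwoOthers_clsStr : ¬ HasTwoOthers clsStr 0 := by
  have mate : ∀ b : Fin 45, cls 0 = cls b → 0 ≠ b → b = 1 := by unfold cls; decide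
  rintro ⟨b, c, ⟨h₁, h₂⟩, h₃, h₄, h₅⟩
  exact h₅ ((mate b h₁ h₃).trans (mate c h₂ h₄).symm)

lemma type2_eq_of_equiv3 {N : Type} {T : Str (Fin 4) N} (h : Equiv3 clsStr T) (a b : N) :
    Type2 T a a = Type2 T b b := by
  have transfer : ∀ φ : FO2 (Fin 4), (∀ m, Sat2 clsStr φ m m) → ∀ n, Sat2 T φ n n :=
    fun φ hφ n => (sat_diagonalSentence T φ fun _ => n).1
      ((h _ (sentence_diagonalSentence φ)).1
        (fun v => (sat_diagonalSentence _ φ v).2 hφ) _) n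
  ext φ
  by_cases h0 : Sat2 clsStr φ 0 0
  · have := transfer φ fun m => (sat_clsStr_iff φ _ _ (by simp) (by simp)).1 h0
    exact iff_of_true (this a) (this b)
  · have := transfer (.not φ) fun m hm => h0 <|
      (sat_clsStr_iff φ _ _ (by simp) (by simp)).1 hm
    exact iff_of_false (this a) (this b)

/-- There are a binary relational language with exactly four
binary relation symbols and a finite model with 45 elements that is not
3-equivalent to any transitive model. -/
theorem stmt3 :
    ∃ (L : Type) (_ : Fintype L), Fintype.card L = 4 ∧
      ∃ (M : Type) (_ : Fintype M) (S : Str L M), Fintype.card M = 45 ∧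
        ∀ (N : Type) (T : Str L N), Nonempty N → IsTransitive T → ¬ Equiv3 S T := by
  refine ⟨Fin 4, inferInstance, rfl, Fin 45, inferInstance, clsStr, rfl, ?_⟩
  rintro N T ⟨n⟩ hT h
  obtain ⟨a, ha⟩ := (h (.ex 0 twoOthers) (diff_variables_eq_empty _)).1
    (fun v => ⟨42, (sat_twoOthers _ v _).2 hasTwoOthers_clsStr⟩) fun _ => n
  obtain ⟨b, hb⟩ := (h (.ex 0 (.not twoOthers)) (diff_variables_eq_empty _)).1
    (fun v => ⟨0, fun h0 => not_hasTwoOthers_clsStr ((sat_twoOthers _ v _).1 h0)⟩) fun _ => n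
  obtain ⟨f, hf, rfl⟩ := hT a b (type2_eq_of_equiv3 h a b)
  exact hb ((sat_twoOthers _ _ _).2 (((sat_twoOthers _ _ _).1 ha).map hf))

end AN
end
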